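/- For a knot-theoretic ternary quasigroup (KTQ) X and every n: ∂_n(C_n^D(X)) ⊆ C_{n-1}^D(X), where ∂_n = ∂_n^L - ∂_n^R. Hence (C_n^D(X), ∂_n) is a chain subcomplex of (C_n(X), ∂_n). -/

import Mathlib

variable {X : Type*}

/-- The reversed operation `T̂`, with `xyzT̂ = zyxT`. -/
def hatOp (S : X → X → X → X) : X → X → X → X := fun x y z => S z y x

/-- Extend an `(n+2)`-tuple `x = (x_0, …, x_{n+1})` to a function on `ℕ`
(values beyond index `n+1` are irrelevant junk). -/
def ext (n : ℕ) (x : Fin (n + 2) → X) : ℕ → X :=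
  fun m => if h : m < n + 2 then x ⟨m, h⟩ else x 0

/-- Coordinate description of the left face maps: `d_{i,k}^{L}` is `x_k` for
`k > i` and `x_{k-1}x_k(d_{i,k+1}^{L}x)T` for `k ≤ i` (computed right to left). -/
def dLcoord (T : X → X → X → X) (i : ℕ) (x : ℕ → X) (k : ℕ) : X :=
  if h : i < k then x k
  else T (x (k - 1)) (x k) (dLcoord T i x (k + 1))
termination_by i + 1 - k
decreasing_by omega

/-- Coordinate description of the right face maps: `d_{i,k}^{R}` is `x_k` for
`k ≤ i` and `(d_{i,k-1}^{R}x)x_kx_{k+1}T` for `k > i` (computed left to right). -/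
def dRcoord (T : X → X → X → X) (i : ℕ) (x : ℕ → X) (k : ℕ) : X :=
  if h : k ≤ i then x k
  else T (dRcoord T i x (k - 1)) (x k) (x (k + 1))
termination_by k
decreasing_by omega

/-- Inductive description of the left face maps:
`d_0^{L}x = (x_1, …, x_{n+1})` and
`d_i^{L}x = d_{i-1}^{L}(x  with  x_i ↦ x_{i-1}x_ix_{i+1}T)`.
The result is indexed so that entry `k` is the `(k+1)`-st coordinate. -/
def dLind (T : X → X → X → X) : ℕ → (ℕ → X) → ℕ → X
  | 0, x, k => x (k + 1)
  | i + 1, x, k =>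
      dLind T i (fun m => if m = i + 1 then T (x i) (x (i + 1)) (x (i + 2)) else x m) k

/-- The left face map `d_i^{n,L}` (coordinate description), as a map from
`(n+2)`-tuples to `(n+1)`-tuples; entry `p` is the coordinate `d_{i,p+1}^{n,L}`. -/
def dL (T : X → X → X → X) (n i : ℕ) (x : Fin (n + 2) → X) : Fin (n + 1) → X :=
  fun p => dLcoord T i (ext n x) (p.1 + 1)

/-- The left face map `d_i^{n,L}` (inductive description). -/
def dLInd (T : X → X → X → X) (n i : ℕ) (x : Fin (n + 2) → X) : Fin (n + 1) → X :=
  fun p => dLind T i (ext n x) p.1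

/-- The right face map `d_i^{n,R}`; entry `p` is the coordinate `d_{i,p}^{n,R}`. -/
def dR (T : X → X → X → X) (n i : ℕ) (x : Fin (n + 2) → X) : Fin (n + 1) → X :=
  fun p => dRcoord T i (ext n x) p.1

/-- The boundary homomorphism `∂_{n}^{L} = Σ_{i=0}^{n} (-1)^i d_i^{n,L}`
on the free abelian group on `(n+2)`-tuples (used for `n ≥ 1`). -/
def boundaryL (T : X → X → X → X) (n : ℕ) :
    FreeAbelianGroup (Fin (n + 2) → X) →+ FreeAbelianGroup (Fin (n + 1) → X) :=
  FreeAbelianGroup.lift fun x =>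
    ∑ i ∈ Finset.range (n + 1), ((-1 : ℤ) ^ i) • FreeAbelianGroup.of (dL T n i x)

/-- The boundary homomorphism `∂_{n}^{R} = Σ_{i=0}^{n} (-1)^i d_i^{n,R}`. -/
def boundaryR (T : X → X → X → X) (n : ℕ) :
    FreeAbelianGroup (Fin (n + 2) → X) →+ FreeAbelianGroup (Fin (n + 1) → X) :=
  FreeAbelianGroup.lift fun x =>
    ∑ i ∈ Finset.range (n + 1), ((-1 : ℤ) ^ i) • FreeAbelianGroup.of (dR T n i x)

/-- The boundary homomorphism `∂_n = ∂_n^L - ∂_n^R`. -/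
def boundary (T : X → X → X → X) (n : ℕ) :
    FreeAbelianGroup (Fin (n + 2) → X) →+ FreeAbelianGroup (Fin (n + 1) → X) :=
  boundaryL T n - boundaryR T n

/-- An `(m+2)`-tuple is degenerate if it contains, on three consecutive
coordinates, a triple `(a, b, abbR)` (condition D1) or `(bbaL, b, a)`
(condition D2). -/
def IsDegenerate (L R : X → X → X → X) (m : ℕ) (x : Fin (m + 2) → X) : Prop :=
  ∃ (j : ℕ) (h : j + 2 < m + 2) (a b : X),
    (x ⟨j, by omega⟩ = a ∧ x ⟨j + 1, by omega⟩ = b ∧ x ⟨j + 2, h⟩ = R a b b) ∨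
    (x ⟨j, by omega⟩ = L b b a ∧ x ⟨j + 1, by omega⟩ = b ∧ x ⟨j + 2, h⟩ = a)

/-- `C_m^D(X)`: the subgroup of `C_m(X)` generated by the degenerate tuples. -/
def CD (L R : X → X → X → X) (m : ℕ) :
    AddSubgroup (FreeAbelianGroup (Fin (m + 2) → X)) :=
  AddSubgroup.closure {c | ∃ x, IsDegenerate L R m x ∧ c = FreeAbelianGroup.of x}

/-- `x[j]`: the tuple obtained from `x` by replacing `x_j` with `x_{j-1}x_jx_{j+1}T`. -/
def tupleSub (T : X → X → X → X) (m : ℕ) (x : Fin (m + 2) → X) (j : ℕ)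
    (h1 : 1 ≤ j) (h2 : j ≤ m) : Fin (m + 2) → X :=
  Function.update x ⟨j, by omega⟩
    (T (x ⟨j - 1, by omega⟩) (x ⟨j, by omega⟩) (x ⟨j + 1, by omega⟩))

/-- `C_m^I(X)`: the subgroup of `C_m(X)` generated by the sums `x + x[j]`,
`1 ≤ j ≤ m`. -/
def CI (T : X → X → X → X) (m : ℕ) :
    AddSubgroup (FreeAbelianGroup (Fin (m + 2) → X)) :=
  AddSubgroup.closure {c | ∃ (x : Fin (m + 2) → X) (j : ℕ) (h1 : 1 ≤ j) (h2 : j ≤ m),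
    c = FreeAbelianGroup.of x + FreeAbelianGroup.of (tupleSub T m x j h1 h2)}

/-- `C_m^{ID}(X)`: the subgroup of `C_m(X)` generated by the sums `x + x[j]`
together with the degenerate tuples. -/
def CID (T L R : X → X → X → X) (m : ℕ) :
    AddSubgroup (FreeAbelianGroup (Fin (m + 2) → X)) :=
  AddSubgroup.closure
    ({c | ∃ (x : Fin (m + 2) → X) (j : ℕ) (h1 : 1 ≤ j) (h2 : j ≤ m),
        c = FreeAbelianGroup.of x + FreeAbelianGroup.of (tupleSub T m x j h1 h2)} ∪
      {c | ∃ x, IsDegenerate L R m x ∧ c = FreeAbelianGroup.of x})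

/-- Reversal of a tuple. -/
def revTuple {m : ℕ} (x : Fin m → X) : Fin m → X := fun k => x k.rev

/-- A tuple is degenerate iff `T` fixes the middle entry of some three consecutive entries. -/
theorem isDegenerate_iff {T L R : X → X → X → X}
    (hq2 : ∀ x1 x2 x3 : X, T (L x1 x2 x3) x2 x3 = x1)
    (hq5 : ∀ x1 x2 x3 : X, R x1 x2 (T x1 x2 x3) = x3)
    (hq6 : ∀ x1 x2 x3 : X, T x1 x2 (R x1 x2 x3) = x3)
    {m : ℕ} {x : Fin (m + 2) → X} :
    IsDegenerate L R m x ↔ ∃ (j : ℕ) (h : j + 2 < m + 2),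
      T (x ⟨j, by omega⟩) (x ⟨j + 1, by omega⟩) (x ⟨j + 2, h⟩) = x ⟨j + 1, by omega⟩ := by
  constructor
  · rintro ⟨j, h, a, b, ⟨h0, h1, h2⟩ | ⟨h0, h1, h2⟩⟩
    · exact ⟨j, h, by rw [h0, h1, h2, hq6]⟩
    · exact ⟨j, h, by rw [h0, h1, h2, hq2]⟩
  · rintro ⟨j, h, hT⟩
    refine ⟨j, h, _, _, Or.inl ⟨rfl, rfl, ?_⟩⟩
    have := hq5 (x ⟨j, by omega⟩) (x ⟨j + 1, by omega⟩) (x ⟨j + 2, h⟩)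
    rw [hT] at this
    exact this.symm

theorem ext_of_lt {n m : ℕ} (x : Fin (n + 2) → X) (h : m < n + 2) : ext n x m = x ⟨m, h⟩ :=
  dif_pos h

theorem dLcoord_of_lt (T : X → X → X → X) {i k : ℕ} (x : ℕ → X) (h : i < k) :
    dLcoord T i x k = x k := by
  rw [dLcoord, dif_pos h]

theorem dLcoord_of_le (T : X → X → X → X) {i k : ℕ} (x : ℕ → X) (h : k + 1 ≤ i) :
    dLcoord T i x (k + 1) = T (x k) (x (k + 1)) (dLcoord T i x (k + 2)) := by
  rw [dLcoord, dif_neg (by omega), Nat.add_sub_cancel]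

theorem dRcoord_of_le (T : X → X → X → X) {i k : ℕ} (x : ℕ → X) (h : k ≤ i) :
    dRcoord T i x k = x k := by
  rw [dRcoord, dif_pos h]

theorem dRcoord_of_lt (T : X → X → X → X) {i k : ℕ} (x : ℕ → X) (h : i < k + 1) :
    dRcoord T i x (k + 1) = T (dRcoord T i x k) (x (k + 1)) (x (k + 2)) := by
  rw [dRcoord, dif_neg (by omega), Nat.add_sub_cancel]

theorem dLcoord_succ_eq {T : X → X → X → X} {x : ℕ → X} {j : ℕ}
    (hx : T (x j) (x (j + 1)) (x (j + 2)) = x (j + 1)) (k : ℕ) :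
    dLcoord T j x (k + 1) = dLcoord T (j + 1) x (k + 1) := by
  rcases le_or_gt k j with hk | hk
  · induction hk using Nat.decreasingInduction with
    | self =>
      rw [dLcoord_of_lt T x (by omega), dLcoord_of_le T x le_rfl, dLcoord_of_lt T x (by omega), hx]
    | of_succ l hl ih =>
      rw [dLcoord_of_le T x (by omega : l + 1 ≤ j), dLcoord_of_le T x (by omega : l + 1 ≤ j + 1), ih]
  · rw [dLcoord_of_lt T x (by omega), dLcoord_of_lt T x (by omega)]

theorem dRcoord_succ_eq {T : X → X → X → X} {x : ℕ → X} {j : ℕ}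
    (hx : T (x j) (x (j + 1)) (x (j + 2)) = x (j + 1)) (k : ℕ) :
    dRcoord T j x k = dRcoord T (j + 1) x k := by
  induction k with
  | zero => rw [dRcoord_of_le T x (by omega), dRcoord_of_le T x (by omega)]
  | succ k ih =>
    rcases lt_trichotomy k j with hk | rfl | hk
    · rw [dRcoord_of_le T x (by omega), dRcoord_of_le T x (by omega)]
    · rw [dRcoord_of_lt T x (by omega), dRcoord_of_le T x le_rfl, dRcoord_of_le T x le_rfl, hx]
    · rw [dRcoord_of_lt T x (by omega), dRcoord_of_lt T x (by omega), ih]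

/-- An alternating sum lies in a subgroup if two consecutive terms cancel and all others
belong to the subgroup. -/
theorem alternating_sum_mem {G : Type*} [AddCommGroup G] (S : AddSubgroup G) {f : ℕ → G}
    {N q : ℕ} (hq : q + 1 < N) (hf : f q = f (q + 1))
    (hS : ∀ i < N, i ≠ q → i ≠ q + 1 → f i ∈ S) :
    ∑ i ∈ Finset.range N, ((-1 : ℤ) ^ i) • f i ∈ S := by
  rw [← Finset.add_sum_erase _ _ (Finset.mem_range.2 (by omega : q < N)),
    ← Finset.add_sum_erase _ _ (Finset.mem_erase.2
      ⟨Nat.succ_ne_self q, Finset.mem_range.2 hq⟩), ← add_assoc, hf, pow_succ, mul_neg_one,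
    neg_smul, add_neg_cancel, zero_add]
  refine S.sum_mem fun i hi => S.zsmul_mem (hS i ?_ ?_ ?_) _ <;> simp_all

/-- for a KTQ `X` and every `n`, `∂_n(C_n^D(X)) ⊆ C_{n-1}^D(X)`
where `∂_n = ∂_n^L - ∂_n^R`; hence `(C_n^D(X), ∂_n)` is a chain subcomplex of
`(C_n(X), ∂_n)` (the cases of nonpositive degree being trivial). -/
theorem boundary_maps_CD_into_CD {X : Type*} (T L M R : X → X → X → X)
    (hq1 : ∀ x1 x2 x3 : X, L (T x1 x2 x3) x2 x3 = x1)
    (hq2 : ∀ x1 x2 x3 : X, T (L x1 x2 x3) x2 x3 = x1)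
    (hq3 : ∀ x1 x2 x3 : X, M x1 (T x1 x2 x3) x3 = x2)
    (hq4 : ∀ x1 x2 x3 : X, T x1 (M x1 x2 x3) x3 = x2)
    (hq5 : ∀ x1 x2 x3 : X, R x1 x2 (T x1 x2 x3) = x3)
    (hq6 : ∀ x1 x2 x3 : X, T x1 x2 (R x1 x2 x3) = x3)
    (hA3L : ∀ a b c d : X, T (T a b c) c d = T (T a b (T b c d)) (T b c d) d)
    (hA3R : ∀ a b c d : X, T a b (T b c d) = T a (T a b c) (T (T a b c) c d)) :
    ∀ n : ℕ, ∀ c ∈ CD L R (n + 1), boundary T (n + 1) c ∈ CD L R n := by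
  intro n c hc
  refine AddSubgroup.closure_le ((CD L R n).comap (boundary T (n + 1))) |>.2 ?_ hc
  rintro _ ⟨x, hx, rfl⟩
  obtain ⟨j, hj, hT⟩ := (isDegenerate_iff hq2 hq5 hq6).1 hx
  have hxj : T (ext (n + 1) x j) (ext (n + 1) x (j + 1)) (ext (n + 1) x (j + 2)) =
      ext (n + 1) x (j + 1) := by
    rwa [ext_of_lt x (by omega), ext_of_lt x (by omega), ext_of_lt x (by omega)]
  have of_mem : ∀ y, IsDegenerate L R n y → FreeAbelianGroup.of y ∈ CD L R n :=
    fun y hy => AddSubgroup.subset_closure ⟨y, hy, rfl⟩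
  simp only [SetLike.mem_coe, AddSubgroup.mem_comap, boundary, AddMonoidHom.sub_apply,
    boundaryL, boundaryR, FreeAbelianGroup.lift_apply_of]
  refine sub_mem (alternating_sum_mem _ (q := j) (by omega) ?_ fun i hi hij hij' => of_mem _ ?_)
    (alternating_sum_mem _ (q := j) (by omega) ?_ fun i hi hij hij' => of_mem _ ?_)
  · exact congrArg _ (funext fun p => dLcoord_succ_eq hxj p)
  · rw [isDegenerate_iff hq2 hq5 hq6]
    rcases lt_or_gt_of_ne hij with h | h
    · obtain ⟨j, rfl⟩ := Nat.exists_eq_succ_of_ne_zero (by omega : j ≠ 0)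
      refine ⟨j, by omega, ?_⟩
      simp only [dL]
      rw [dLcoord_of_lt T _ (by omega), dLcoord_of_lt T _ (by omega),
        dLcoord_of_lt T _ (by omega)]
      exact hxj
    · refine ⟨j, by omega, ?_⟩
      simp only [dL]
      rw [dLcoord_of_le T (k := j) _ (by omega), dLcoord_of_le T (k := j + 1) _ (by omega),
        ← hA3L, hxj]
  · exact congrArg _ (funext fun p => dRcoord_succ_eq hxj p)
  · rw [isDegenerate_iff hq2 hq5 hq6]
    rcases lt_or_gt_of_ne hij with h | h
    · obtain ⟨j, rfl⟩ := Nat.exists_eq_succ_of_ne_zero (by omega : j ≠ 0)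
      refine ⟨j, by omega, ?_⟩
      simp only [dR]
      rw [dRcoord_of_lt T (k := j + 1) _ (by omega), dRcoord_of_lt T (k := j) _ (by omega),
        ← hA3R, hxj]
    · refine ⟨j, by omega, ?_⟩
      simp only [dR]
      rw [dRcoord_of_le T _ (by omega), dRcoord_of_le T _ (by omega),
        dRcoord_of_le T _ (by omega)]
      exact hxj
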